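/- Let W_{p,1} = C_p ⋈ Δ_1 be the wedge product of a p-gon and a 1-simplex, p ≥ 3, with vertices encoded as vectors over the facet-label alphabet {0, 1, [2]} (where [2] = {0,1}). Define, for k = 0,…,p−2, the vertices v_k = (0,…,0, [2], [2], 1,…,1) (k leading zeros, then [2],[2], then p−k−2 ones) and v̄_k = (1,…,1, [2], [2], 0,…,0) (k leading ones, then [2],[2], then p−k−2 zeros), together with v_{p−1} = ([2], 0,…,0, [2]) and v̄_{p−1} = ([2], 1,…,1, [2]). Then A = {v_k : k = 0,…,p−1} ∪ {v̄_k : k = 0,…,p−1} is an affine support set of W_{p,1} of cardinality 2p. -/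

import Mathlib

open Matrix Set

noncomputable section

def setDim {V : Type*} [AddCommGroup V] [Module ℝ V] (s : Set V) : ℕ :=
  Module.finrank ℝ (affineSpan ℝ s).direction

def IsFaceOf {V : Type*} [AddCommGroup V] [Module ℝ V] (F P : Set V) : Prop :=
  F ⊆ P ∧ ∃ (c : V →ₗ[ℝ] ℝ) (b : ℝ), (∀ x ∈ P, c x ≤ b) ∧ F = {x ∈ P | c x = b}

def IsVertexOf {V : Type*} [AddCommGroup V] [Module ℝ V] (v : V) (P : Set V) : Prop :=
  IsFaceOf {v} P

def IsFacetOf {V : Type*} [AddCommGroup V] [Module ℝ V] (F P : Set V) : Prop :=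
  IsFaceOf F P ∧ F.Nonempty ∧ setDim F + 1 = setDim P

/-- The vertex vector `v_k` of `W_{p,1}`: entries `[2] = {0,1}` at the two cyclically
adjacent positions `k, k+1`, entries `0` before and entries `1` after. -/
def suppVec (p : ℕ) (k : ZMod p) : ZMod p → Set (ZMod 2) :=
  fun i => if i = k ∨ i = k + 1 then Set.univ
    else if i.val < k.val then {0} else {1}

/-- The vertex vector `v̄_k` of `W_{p,1}`: entries `[2] = {0,1}` at the positions
`k, k+1`, entries `1` before and entries `0` after. -/
def suppVecBar (p : ℕ) (k : ZMod p) : ZMod p → Set (ZMod 2) :=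
  fun i => if i = k ∨ i = k + 1 then Set.univ
    else if i.val < k.val then {1} else {0}

/-- Integer description of the incidence between the `n`-th vertex and the `N`-th facet, both
numbered modulo `2 * p`: the difference `n + 1 - N` reduced modulo `2 * p` is at most `p + 1`. -/
def OnFacet (p n N : ℤ) : Prop :=
  (0 ≤ n + 1 - N ∧ n + 1 - N ≤ p + 1) ∨ n + 1 - N ≤ 1 - p ∨ n + 1 - N = 2 * p

lemma ZMod.eq_add_one_iff_val {p : ℕ} [NeZero p] (hp : 2 ≤ p) (k l : ZMod p) :
    l = k + 1 ↔ l.val = if k.val + 1 = p then 0 else k.val + 1 := by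
  have : Fact (1 < p) := ⟨hp⟩
  have hk := ZMod.val_lt k
  rw [← (ZMod.val_injective p).eq_iff, ZMod.val_add, ZMod.val_one]
  split_ifs with h
  · rw [h, Nat.mod_self]
  · rw [Nat.mod_eq_of_lt (by omega)]

lemma mem_suppVec_iff {p : ℕ} [NeZero p] (hp : 3 ≤ p) (k l : ZMod p) (m : ZMod 2) :
    m ∈ suppVec p k l ↔ OnFacet p k.val (l.val + p * m.val) := by
  have hk := ZMod.val_lt k
  have hl := ZMod.val_lt l
  unfold suppVec OnFacet
  simp only [← (ZMod.val_injective p).eq_iff (a := l) (b := k),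
    ZMod.eq_add_one_iff_val (show 2 ≤ p by omega) k l]
  generalize k.val = κ at *
  generalize l.val = lam at *
  obtain rfl | rfl : m = 0 ∨ m = 1 := by revert m; decide
  · rw [show ZMod.val (0 : ZMod 2) = 0 from rfl]
    split_ifs <;> simp <;> omega
  · rw [show ZMod.val (1 : ZMod 2) = 1 from rfl]
    split_ifs <;> simp <;> omega

lemma mem_suppVecBar_iff {p : ℕ} [NeZero p] (hp : 3 ≤ p) (k l : ZMod p) (m : ZMod 2) :
    m ∈ suppVecBar p k l ↔ OnFacet p (k.val + p) (l.val + p * m.val) := by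
  have hk := ZMod.val_lt k
  have hl := ZMod.val_lt l
  unfold suppVecBar OnFacet
  simp only [← (ZMod.val_injective p).eq_iff (a := l) (b := k),
    ZMod.eq_add_one_iff_val (show 2 ≤ p by omega) k l]
  generalize k.val = κ at *
  generalize l.val = lam at *
  obtain rfl | rfl : m = 0 ∨ m = 1 := by revert m; decide
  · rw [show ZMod.val (0 : ZMod 2) = 0 from rfl]
    split_ifs <;> simp <;> omega
  · rw [show ZMod.val (1 : ZMod 2) = 1 from rfl]
    split_ifs <;> simp <;> omega

/-- Every number below `2 * p` is the number of a facet of the wedge product. -/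
lemma exists_facet_index {p : ℕ} [NeZero p] {N : ℤ} (h0 : 0 ≤ N) (h1 : N < 2 * p) :
    ∃ (l : ZMod p) (m : ZMod 2), (l.val + p * m.val : ℤ) = N := by
  lift N to ℕ using h0
  by_cases h : N < p
  · refine ⟨(N : ZMod p), 0, ?_⟩
    rw [ZMod.val_natCast_of_lt h]
    simp
  · refine ⟨((N - p : ℕ) : ZMod p), 1, ?_⟩
    rw [ZMod.val_natCast_of_lt (by omega), show ZMod.val (1 : ZMod 2) = 1 from rfl]
    push_cast [not_lt.mp h]
    ring

lemma facet_index_bounds {p : ℕ} [NeZero p] (l : ZMod p) (m : ZMod 2) :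
    (0 : ℤ) ≤ l.val + p * m.val ∧ (l.val + p * m.val : ℤ) < 2 * p := by
  have hl := ZMod.val_lt l
  obtain rfl | rfl : m = 0 ∨ m = 1 := by revert m; decide
  · rw [show ZMod.val (0 : ZMod 2) = 0 from rfl]; omega
  · rw [show ZMod.val (1 : ZMod 2) = 1 from rfl]; omega

lemma eq_of_forall_onFacet_iff {p n n' : ℤ} (hp : 3 ≤ p) (h0 : 0 ≤ n) (h1 : n < 2 * p)
    (h0' : 0 ≤ n') (h1' : n' < 2 * p)
    (h : ∀ N, 0 ≤ N → N < 2 * p → (OnFacet p n N ↔ OnFacet p n' N)) : n = n' := by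
  unfold OnFacet at h
  have key : ∀ q : ℤ, 0 ≤ q → q < 4 * p → ∃ N, 0 ≤ N ∧ N < 2 * p ∧ (N = q ∨ N = q - 2 * p) := by
    intro q hq hq'
    by_cases hlt : q < 2 * p
    · exact ⟨q, hq, hlt, Or.inl rfl⟩
    · exact ⟨q - 2 * p, by omega, by omega, Or.inr rfl⟩
  obtain ⟨N, hN0, hN1, hN⟩ := key (n + 1) (by omega) (by omega)
  obtain ⟨M, hM0, hM1, hM⟩ := key (n + 2) (by omega) (by omega)
  have e1 := h N hN0 hN1
  have e2 := h M hM0 hM1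
  omega

/-- The two families of vertex vectors, numbered consecutively. -/
lemma exists_vertex_index {p : ℕ} [NeZero p] (hp : 3 ≤ p) {H : ZMod p → Set (ZMod 2)}
    (hH : H ∈ Set.range (suppVec p) ∪ Set.range (suppVecBar p)) :
    ∃ n : ℤ, 0 ≤ n ∧ n < 2 * p ∧
      ∀ l m, m ∈ H l ↔ OnFacet p n (l.val + p * m.val) := by
  rcases hH with ⟨k, rfl⟩ | ⟨k, rfl⟩
  · have hk := ZMod.val_lt k
    exact ⟨k.val, by omega, by omega, mem_suppVec_iff hp k⟩
  · have hk := ZMod.val_lt k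
    exact ⟨k.val + p, by omega, by omega, mem_suppVecBar_iff hp k⟩

lemma index_eq_of_mem_iff {p : ℕ} [NeZero p] (hp : 3 ≤ p) {H : ZMod p → Set (ZMod 2)} {n n' : ℤ}
    (h0 : 0 ≤ n) (h1 : n < 2 * p) (h0' : 0 ≤ n') (h1' : n' < 2 * p)
    (h : ∀ l m, m ∈ H l ↔ OnFacet p n (l.val + p * m.val))
    (h' : ∀ l m, m ∈ H l ↔ OnFacet p n' (l.val + p * m.val)) : n = n' := by
  refine eq_of_forall_onFacet_iff (by exact_mod_cast hp) h0 h1 h0' h1' fun N hN0 hN1 => ?_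
  obtain ⟨l, m, rfl⟩ := exists_facet_index hN0 hN1
  rw [← h, ← h']

lemma ncard_suppVec_union_suppVecBar {p : ℕ} [NeZero p] (hp : 3 ≤ p) :
    (Set.range (suppVec p) ∪ Set.range (suppVecBar p)).ncard = 2 * p := by
  have inj : Function.Injective (suppVec p) := fun k k' h => by
    have hk := ZMod.val_lt k
    have hk' := ZMod.val_lt k'
    have := index_eq_of_mem_iff hp (by omega) (by omega) (by omega) (by omega)
      (mem_suppVec_iff hp k) (h ▸ mem_suppVec_iff hp k')
    exact ZMod.val_injective p (by exact_mod_cast this)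
  have injBar : Function.Injective (suppVecBar p) := fun k k' h => by
    have hk := ZMod.val_lt k
    have hk' := ZMod.val_lt k'
    have := index_eq_of_mem_iff hp (by omega) (by omega) (by omega) (by omega)
      (mem_suppVecBar_iff hp k) (h ▸ mem_suppVecBar_iff hp k')
    exact ZMod.val_injective p (by omega)
  have disj : Disjoint (Set.range (suppVec p)) (Set.range (suppVecBar p)) := by
    rw [Set.disjoint_left]
    rintro _ ⟨k, rfl⟩ ⟨k', h⟩
    have hk := ZMod.val_lt k
    have hk' := ZMod.val_lt k'
    have := index_eq_of_mem_iff hp (by omega) (by omega) (by omega) (by omega)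
      (mem_suppVec_iff hp k) (h ▸ mem_suppVecBar_iff hp k')
    omega
  rw [Set.ncard_union_eq disj (Set.finite_range _) (Set.finite_range _),
    ← Set.image_univ, ← Set.image_univ, Set.ncard_image_of_injective _ inj,
    Set.ncard_image_of_injective _ injBar, Set.ncard_univ, Nat.card_zmod, two_mul]

/-- A linear functional that is maximal on a polyhedron at `g` is also maximal at every point
satisfying all the constraints that are tight at `g` with equality. -/
lemma eq_max_of_tight {V ι : Type*} [AddCommGroup V] [Module ℝ V] [Finite ι]
    (φ : ι → V →ₗ[ℝ] ℝ) {g w : V} (hg : ∀ i, φ i g ≤ 1) (hw : ∀ i, φ i w ≤ 1)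
    (htight : ∀ i, φ i g = 1 → φ i w = 1) (c : V →ₗ[ℝ] ℝ) {β : ℝ}
    (hc : ∀ x, (∀ i, φ i x ≤ 1) → c x ≤ β) (hcg : c g = β) : c w = β := by
  have hev : ∀ᶠ ε : ℝ in nhdsWithin 0 (Set.Ioi 0),
      ∀ i, φ i (g + ε • (g - w)) ≤ 1 := by
    rw [Filter.eventually_all]
    intro i
    simp only [map_add, map_smul, map_sub, smul_eq_mul]
    rcases (hg i).eq_or_lt with h | h
    · simp [h, htight i h]
    · have hcont : Continuous fun ε : ℝ => φ i g + ε * (φ i g - φ i w) := by fun_prop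
      have := (hcont.tendsto 0).eventually (gt_mem_nhds (show φ i g + 0 * (φ i g - φ i w) < 1 by simpa using h))
      exact (this.filter_mono nhdsWithin_le_nhds).mono fun _ hε => hε.le
  obtain ⟨ε, hε, hpos⟩ := (hev.and self_mem_nhdsWithin).exists
  have h1 := hc _ hε
  have hpos : 0 < ε := hpos
  simp only [map_add, map_smul, map_sub, smul_eq_mul, hcg] at h1
  exact le_antisymm (hc w hw) (by nlinarith)

/-- A proper face of a polyhedron lies on one of the bounding hyperplanes. -/
lemma exists_forall_tight_of_face_ne {V ι : Type*} [AddCommGroup V] [Module ℝ V] [Fintype ι]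
    [Nonempty ι] (φ : ι → V →ₗ[ℝ] ℝ) {F : Set V} (hF : IsFaceOf F {x | ∀ i, φ i x ≤ 1})
    (hne : F ≠ {x | ∀ i, φ i x ≤ 1}) : ∃ i, ∀ x ∈ F, φ i x = 1 := by
  by_contra! hcon
  choose x hxF hx using hcon
  obtain ⟨hsub, c, β, hc, hFeq⟩ := hF
  have hcx : ∀ i, c (x i) = β := fun i => (hFeq ▸ hxF i : x i ∈ {x ∈ _ | c x = β}).2
  have hle : ∀ i j, φ i (x j) ≤ 1 := fun i j => hsub (hxF j) i
  have hn : (0 : ℝ) < Fintype.card ι := by exact_mod_cast Fintype.card_pos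
  set g : V := (Fintype.card ι : ℝ)⁻¹ • ∑ j, x j with hgdef
  have hcg : c g = β := by
    simp only [hgdef, map_smul, map_sum, hcx, Finset.sum_const, Finset.card_univ, nsmul_eq_mul,
      smul_eq_mul]
    field_simp
  have hlt : ∀ i, φ i g < 1 := by
    intro i
    simp only [hgdef, map_smul, map_sum, smul_eq_mul]
    rw [inv_mul_lt_iff₀ hn]
    calc ∑ j, φ i (x j) < ∑ _j : ι, (1 : ℝ) :=
          Finset.sum_lt_sum (fun j _ => hle i j)
            ⟨i, Finset.mem_univ i, lt_of_le_of_ne (hle i i) (hx i)⟩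
      _ = Fintype.card ι * 1 := by simp
  refine hne (hsub.antisymm fun w hw => ?_)
  rw [hFeq]
  exact ⟨hw, eq_max_of_tight φ (fun i => (hlt i).le) hw (fun i h => absurd h (hlt i).ne) c hc hcg⟩

/-- A ranked set of points is affinely independent if every point is separated from all points of
higher rank by a hyperplane containing the latter. -/
lemma affineIndependent_of_triangular {V : Type*} [AddCommGroup V] [Module ℝ V] {s : Set V}
    (r : s → ℤ) (hr : Function.Injective r)
    (h : ∀ z : s, ∃ (c : V →ₗ[ℝ] ℝ) (β : ℝ), c z ≠ β ∧ ∀ z' : s, r z < r z' → c z' = β) :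
    AffineIndependent ℝ (fun z : s => z.1) := by
  rw [affineIndependent_iff]
  intro t w hw hwz
  by_contra! hcon
  obtain ⟨z₀, hz₀, hwz₀⟩ := hcon
  obtain ⟨z, hz, hmin⟩ := (t.filter fun z => w z ≠ 0).exists_min_image r
    ⟨z₀, Finset.mem_filter.mpr ⟨hz₀, hwz₀⟩⟩
  rw [Finset.mem_filter] at hz
  obtain ⟨c, β, hcz, hc⟩ := h z
  have hsum : ∑ y ∈ t, w y * (c y - β) = 0 := by
    have h1 := congrArg c hwz
    simp only [map_sum, map_smul, smul_eq_mul, map_zero] at h1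
    simp only [mul_sub, Finset.sum_sub_distrib, ← Finset.sum_mul, h1, hw, zero_mul, sub_zero]
  rw [Finset.sum_eq_single_of_mem z hz.1] at hsum
  · exact (mul_ne_zero hz.2 (sub_ne_zero.mpr hcz)) hsum
  · intro y hy hyz
    by_cases hwy : w y = 0
    · rw [hwy, zero_mul]
    · have hle := hmin y (Finset.mem_filter.mpr ⟨hy, hwy⟩)
      rw [hc y (lt_of_le_of_ne hle fun e => hyz (hr e.symm)), sub_self, mul_zero]

/-- The linear part of the inequality of the wedge product with label `ij`. -/
def wedgeForm {p : ℕ} (a : ZMod p → Fin 2 → ℝ) (b : ZMod 2 → Fin 1 → ℝ) (ij : ZMod p × ZMod 2) :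
    ((Fin 2 → ℝ) × (ZMod p → Fin 1 → ℝ)) →ₗ[ℝ] ℝ where
  toFun z := a ij.1 ⬝ᵥ z.1 + b ij.2 ⬝ᵥ z.2 ij.1
  map_add' x y := by simp only [Prod.fst_add, Prod.snd_add, Pi.add_apply, dotProduct_add]; ring
  map_smul' t x := by
    simp only [Prod.smul_fst, Prod.smul_snd, Pi.smul_apply, dotProduct_smul, smul_eq_mul,
      RingHom.id_apply]
    ring

/-- For `p ≥ 3`, the set `A = {v_k} ∪ {v̄_k}` (`k = 0, …, p-1`) of
`2p` vertices of the wedge product `W_{p,1} = C_p ⋈ Δ_1` is an affine support set: in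
every realization of `W_{p,1}` and for every facet, the vertices of `A` lying on that
facet are affinely independent. -/
theorem wedgeProduct_affine_support_set
    (p : ℕ) [NeZero p] (hp : 3 ≤ p)
    -- the `p`-gon `C_p`:
    (a : ZMod p → Fin 2 → ℝ)
    (C : Set (Fin 2 → ℝ)) (hC : C = {x | ∀ i, a i ⬝ᵥ x ≤ 1})
    (hCbd : Bornology.IsBounded C) (hCdim : setDim C = 2)
    (hCfacets : ∀ i, IsFacetOf {x ∈ C | a i ⬝ᵥ x = 1} C)
    (hCinj : Function.Injective fun i => {x ∈ C | a i ⬝ᵥ x = 1})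
    (hCall : ∀ G, IsFacetOf G C → ∃ i, G = {x ∈ C | a i ⬝ᵥ x = 1})
    (hCcyc : ∀ i i' : ZMod p,
      (∃ v, {x ∈ C | a i ⬝ᵥ x = 1} ∩ {x ∈ C | a i' ⬝ᵥ x = 1} = {v}) ↔
        (i' = i + 1 ∨ i = i' + 1))
    -- the `1`-simplex (segment) `Δ_1`:
    (b : ZMod 2 → Fin 1 → ℝ)
    (Δ : Set (Fin 1 → ℝ)) (hΔ : Δ = {y | ∀ j, b j ⬝ᵥ y ≤ 1})
    (hΔbd : Bornology.IsBounded Δ) (hΔdim : setDim Δ = 1)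
    (hΔfacets : ∀ j, IsFacetOf {y ∈ Δ | b j ⬝ᵥ y = 1} Δ)
    (hΔinj : Function.Injective fun j => {y ∈ Δ | b j ⬝ᵥ y = 1})
    (hΔall : ∀ G, IsFacetOf G Δ → ∃ j, G = {y ∈ Δ | b j ⬝ᵥ y = 1})
    -- the wedge product `W = W_{p,1} = C_p ⋈ Δ_1`:
    (W : Set ((Fin 2 → ℝ) × (ZMod p → Fin 1 → ℝ)))
    (hW : W = {z | ∀ i j, a i ⬝ᵥ z.1 + b j ⬝ᵥ z.2 i ≤ 1})
    -- the set `A` of the `2p` designated vertex vectors: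
    (A : Set (ZMod p → Set (ZMod 2)))
    (hA : A = Set.range (suppVec p) ∪ Set.range (suppVecBar p)) :
    -- `A` has cardinality `2p` …
    A.ncard = 2 * p ∧
    -- … and `A` is an affine support set of `W_{p,1}`: in every realization `W'` of
    -- `W_{p,1}` and on every facet `F'` of `W'`, the vertices corresponding to `A`
    -- that lie on `F'` are affinely independent:
    ∀ (W' : Set (Fin (2 + p) → ℝ))
      (e : {F // IsFaceOf F W} ≃o {F' // IsFaceOf F' W'}),
      ∀ F', IsFacetOf F' W' →
      ∀ s : Set (Fin (2 + p) → ℝ),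
        s = {z | ∃ (u : (Fin 2 → ℝ) × (ZMod p → Fin 1 → ℝ)) (hu : IsVertexOf u W),
              (∃ H ∈ A, ∀ i j, j ∈ H i ↔ a i ⬝ᵥ u.1 + b j ⬝ᵥ u.2 i = 1) ∧
              (e ⟨{u}, hu⟩).1 = {z} ∧ z ∈ F'} →
        AffineIndependent ℝ (fun z : s => z.1) := by
  subst hA
  refine ⟨ncard_suppVec_union_suppVecBar hp, ?_⟩
  intro W' e F' hF' s hs
  have hWφ : W = {z | ∀ ij, wedgeForm a b ij z ≤ 1} := by
    subst hW
    exact Set.ext fun z => ⟨fun h ij => h ij.1 ij.2, fun h i j => h (i, j)⟩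
  have hface : ∀ ij, IsFaceOf {z ∈ W | wedgeForm a b ij z = 1} W := fun ij =>
    ⟨fun z hz => hz.1, wedgeForm a b ij, 1, fun z hz => by rw [hWφ] at hz; exact hz ij, rfl⟩
  have hself : ∀ {V : Type} [AddCommGroup V] [Module ℝ V] (P : Set V), IsFaceOf P P :=
    fun P => ⟨Subset.rfl, 0, 0, by simp, by simp⟩
  obtain ⟨ij, hij⟩ : ∃ ij, ∀ x ∈ (e.symm ⟨F', hF'.1⟩).1, wedgeForm a b ij x = 1 := by
    refine exists_forall_tight_of_face_ne _ (hWφ ▸ (e.symm ⟨F', hF'.1⟩).2) ?_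
    rw [← hWφ]
    intro heq
    have hle : e.symm ⟨W', hself W'⟩ ≤ e.symm ⟨F', hF'.1⟩ := by
      change (e.symm ⟨W', hself W'⟩).1 ⊆ (e.symm ⟨F', hF'.1⟩).1
      rw [heq]
      exact (e.symm ⟨W', hself W'⟩).2.1
    have hsub : W' ⊆ F' := e.symm.le_iff_le.mp hle
    have hdim := hF'.2.2
    rw [hF'.1.1.antisymm hsub] at hdim
    omega
  have hfun : ∀ lm, ∃ (c : (Fin (2 + p) → ℝ) →ₗ[ℝ] ℝ) (β : ℝ),
      ∀ u (hu : IsVertexOf u W) z, (e ⟨{u}, hu⟩).1 = {z} →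
        (c z = β ↔ wedgeForm a b lm u = 1) := by
    intro lm
    obtain ⟨-, c, β, -, hF⟩ := (e ⟨_, hface lm⟩).2
    refine ⟨c, β, fun u hu z huz => ?_⟩
    have huW : u ∈ W := hu.1 rfl
    have hzW : z ∈ W' := (e ⟨{u}, hu⟩).2.1 (huz ▸ rfl)
    calc c z = β ↔ {z} ⊆ (e ⟨_, hface lm⟩).1 := by
          rw [Set.singleton_subset_iff, hF]; exact ⟨fun h => ⟨hzW, h⟩, fun h => h.2⟩
      _ ↔ e ⟨{u}, hu⟩ ≤ e ⟨_, hface lm⟩ := by rw [← huz]; rfl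
      _ ↔ ({u} : Set _) ⊆ {z ∈ W | wedgeForm a b lm z = 1} := e.le_iff_le
      _ ↔ wedgeForm a b lm u = 1 := by
          rw [Set.singleton_subset_iff]; exact ⟨fun h => h.2, fun h => ⟨huW, h⟩⟩
  have hdata : ∀ z : s, ∃ (n : ℤ) (u : _) (hu : IsVertexOf u W), 0 ≤ n ∧ n < 2 * p ∧
      (∀ lm : ZMod p × ZMod 2,
        wedgeForm a b lm u = 1 ↔ OnFacet p n (lm.1.val + p * lm.2.val)) ∧
      (e ⟨{u}, hu⟩).1 = {z.1} ∧ wedgeForm a b ij u = 1 := by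
    rintro ⟨z, hz⟩
    rw [hs] at hz
    obtain ⟨u, hu, ⟨H, hH, hHu⟩, huz, hzF⟩ := hz
    obtain ⟨n, h0, h1, hn⟩ := exists_vertex_index hp hH
    refine ⟨n, u, hu, h0, h1, fun lm => ((hHu lm.1 lm.2).symm.trans (hn lm.1 lm.2)), huz, ?_⟩
    refine hij u ?_
    have hle : e ⟨{u}, hu⟩ ≤ ⟨F', hF'.1⟩ := by
      change (e ⟨{u}, hu⟩).1 ⊆ F'
      rw [huz]
      exact Set.singleton_subset_iff.mpr hzF
    exact (e.le_symm_apply.mpr hle : ({u} : Set _) ⊆ _) rfl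
  choose n u hu hn0 hn1 htight huz hF using hdata
  have hninj : Function.Injective n := by
    intro z z' hzz
    have huu : u z' = u z := by
      obtain ⟨hsub, c, β, hc, hsing⟩ := hu z
      have huW' : u z' ∈ W := (hu z').1 rfl
      have huz1 : c (u z) = β := (hsing ▸ Set.mem_singleton (u z) : u z ∈ {x ∈ W | c x = β}).2
      have := eq_max_of_tight (wedgeForm a b) (g := u z) (w := u z')
        (by have := hsub rfl; rwa [hWφ] at this) (by rwa [hWφ] at huW')
        (fun lm h => by rwa [htight, ← hzz, ← htight]) c (β := β)
        (fun x hx => hc x (by rwa [hWφ])) huz1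
      have hmem : u z' ∈ ({u z} : Set _) := hsing ▸ ⟨huW', this⟩
      exact hmem
    have h1 := huz z
    have h2 := huz z'
    simp only [huu] at h2
    exact Subtype.ext (Set.singleton_injective (h1.symm.trans h2))
  obtain ⟨hN0, hN1⟩ := facet_index_bounds ij.1 ij.2
  have hon := fun z => (htight z ij).mp (hF z)
  generalize (ij.1.val + p * ij.2.val : ℤ) = N at hN0 hN1 hon
  have hp' : (3 : ℤ) ≤ p := by exact_mod_cast hp
  unfold OnFacet at hon htight
  refine affineIndependent_of_triangular
    (fun z => if n z + 1 - N < 0 then n z + 1 - N + 2 * p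
      else if n z + 1 - N = 2 * p then 0 else n z + 1 - N) ?_ ?_
  · intro z z' h
    refine hninj ?_
    have h1 := hn0 z
    have h2 := hn0 z'
    have h3 := hn1 z
    have h4 := hn1 z'
    dsimp only at h
    split_ifs at h <;> omega
  · intro z
    obtain ⟨M, hM0, hM1, hM⟩ : ∃ M : ℤ, 0 ≤ M ∧ M < 2 * p ∧ (M = n z + 2 ∨ M = n z + 2 - 2 * p) := by
      have h1 := hn0 z
      have h3 := hn1 z
      by_cases hlt : n z + 2 < 2 * p
      · exact ⟨n z + 2, by omega, hlt, Or.inl rfl⟩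
      · exact ⟨n z + 2 - 2 * p, by omega, by omega, Or.inr rfl⟩
    obtain ⟨l, m, hlm⟩ := exists_facet_index hM0 hM1
    obtain ⟨c, β, hc⟩ := hfun (l, m)
    have h1 := hn0 z
    have h3 := hn1 z
    have h5 := hon z
    refine ⟨c, β, ?_, fun z' hlt => ?_⟩
    · rw [Ne, hc _ _ _ (huz z), htight, hlm]
      omega
    · rw [hc _ _ _ (huz z'), htight, hlm]
      have h2 := hn0 z'
      have h4 := hn1 z'
      have h6 := hon z'
      split_ifs at hlt <;> omega
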